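/- arXiv:1502.05831 — 3 statements merged into one kernel-verified Lean document; each statement's English description precedes it below -/
import Mathlib

section
/- Let b, c, s be integers with 1 ≤ b, c, s ≤ 20 and b ≥ c. Set p_benign = 1 − 10^{−b}, p_correct = 1 − 10^{−c}, p_crash = p_benign − p_correct, p_synchrony = 1 − 10^{−s}. Then 9of(P_BFT(1)) − 9of(P_XFT(1)) equals b − c + 1 if (b > s and s = c), and equals b − min(c, s) otherwise, where P_BFT(1) = p_benign⁴ + 4(1 − p_benign)·p_benign³ and P_XFT(1) = p_benign³ + 3(1 − p_benign)·p_correct²·p_synchrony². -/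
/-- The number of nines of a probability `p`: `⌊-log₁₀ (1 - p)⌋`. -/
noncomputable def ninesOf (p : ℝ) : ℤ := ⌊-(Real.logb 10 (1 - p))⌋

lemma ninesOf_eq {p : ℝ} {n : ℤ} (hl : (10 : ℝ) ^ (-(n + 1)) < 1 - p)
    (hu : 1 - p ≤ (10 : ℝ) ^ (-n)) : ninesOf p = n := by
  have hp : 0 < 1 - p := lt_trans (by positivity) hl
  have h1 := Real.logb_lt_logb (b := 10) (by norm_num) (by positivity) hl
  have h2 := Real.logb_le_logb_of_le (b := 10) (by norm_num) hp hu
  rw [← Real.rpow_intCast, Real.logb_rpow (by norm_num) (by norm_num)] at h1 h2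
  push_cast at h1 h2
  rw [ninesOf, Int.floor_eq_iff]
  constructor <;> linarith

lemma ninesOf_eq_of_mul {p k : ℝ} {b m j : ℤ}
    (hp : 1 - p = (10 : ℝ) ^ (-b) * k) (hl : (10 : ℝ) ^ (-m) * 10 ^ j < k)
    (hu : k ≤ (10 : ℝ) ^ (-m) * 10 ^ j * 10) : ninesOf p = b + m - 1 - j := by
  have hb : (0 : ℝ) < 10 ^ (-b) := by positivity
  apply ninesOf_eq
  · rw [hp, show -(b + m - 1 - j + 1) = -b + (-m + j) by ring, zpow_add₀ (by norm_num),
      zpow_add₀ (by norm_num)]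
    exact mul_lt_mul_of_pos_left hl hb
  · rw [hp, show -(b + m - 1 - j) = -b + (-m + j + 1) by ring, zpow_add₀ (by norm_num),
      zpow_add_one₀ (by norm_num), zpow_add₀ (by norm_num)]
    exact mul_le_mul_of_nonneg_left hu hb.le

lemma ten_zpow_neg_le_div_ten {m n : ℤ} (h : m < n) :
    (10 : ℝ) ^ (-n) ≤ (10 : ℝ) ^ (-m) / 10 := by
  rw [div_eq_mul_inv, ← zpow_sub_one₀ (by norm_num)]
  exact zpow_le_zpow_right₀ (by norm_num) (by omega)

lemma xpaxos_fault_bounds {e z w : ℝ} (he : 0 < e) (hz : z ≤ 1 / 10)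
    (hez : e ≤ z) (hw : 0 < w) (hwz : w ≤ z / 10) :
    z < 6 * (z + w - z * w) - 3 * (z + w - z * w) ^ 2 - 3 * e + e ^ 2 ∧
      6 * (z + w - z * w) - 3 * (z + w - z * w) ^ 2 - 3 * e + e ^ 2 ≤ z * 10 := by
  have h1 : z ≤ z + w - z * w := by nlinarith
  have h2 : z + w - z * w ≤ 11 / 10 * z := by nlinarith
  generalize z + w - z * w = u at h1 h2
  constructor <;> nlinarith

/-- For `t = 1`, the number of nines of consistency of asynchronous BFT over XPaxos:
`9of(P_BFT(1)) − 9of(P_XFT(1))` equals `b − c + 1` when (`b > s` and `s = c`), and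
`b − min c s` otherwise. -/
theorem nines_bft_minus_xpaxos_t1 (b c s : ℤ)
    (hb1 : 1 ≤ b) (hb20 : b ≤ 20) (hc1 : 1 ≤ c) (hc20 : c ≤ 20)
    (hs1 : 1 ≤ s) (hs20 : s ≤ 20) (hbc : b ≥ c)
    (p_benign p_correct p_crash p_synchrony : ℝ)
    (hpb : p_benign = 1 - (10 : ℝ) ^ (-b))
    (hpc : p_correct = 1 - (10 : ℝ) ^ (-c))
    (hpcr : p_crash = p_benign - p_correct)
    (hps : p_synchrony = 1 - (10 : ℝ) ^ (-s)) :
    ninesOf (p_benign ^ 4 + 4 * (1 - p_benign) * p_benign ^ 3) -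
        ninesOf (p_benign ^ 3 + 3 * (1 - p_benign) * p_correct ^ 2 * p_synchrony ^ 2) =
      if b > s ∧ s = c then b - c + 1 else b - min c s := by
  have hBFT : ninesOf (p_benign ^ 4 + 4 * (1 - p_benign) * p_benign ^ 3) = b + b - 1 - 0 := by
    have he : (0 : ℝ) < 10 ^ (-b) := by positivity
    have he' : (10 : ℝ) ^ (-b) ≤ 1 / 10 := by
      simpa using ten_zpow_neg_le_div_ten (m := 0) (n := b) (by omega)
    apply ninesOf_eq_of_mul (k := (10 : ℝ) ^ (-b) *
      (6 - 8 * (10 : ℝ) ^ (-b) + 3 * ((10 : ℝ) ^ (-b)) ^ 2))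
    · rw [hpb]; ring
    · rw [zpow_zero]
      exact mul_lt_mul_of_pos_left (by nlinarith) he
    · rw [zpow_zero, mul_one]
      exact mul_le_mul_of_nonneg_left (by nlinarith) he.le
  have hq : 1 - (p_benign ^ 3 + 3 * (1 - p_benign) * p_correct ^ 2 * p_synchrony ^ 2) =
      (10 : ℝ) ^ (-b) * (6 * ((10 : ℝ) ^ (-c) + 10 ^ (-s) - 10 ^ (-c) * 10 ^ (-s)) -
        3 * ((10 : ℝ) ^ (-c) + 10 ^ (-s) - 10 ^ (-c) * 10 ^ (-s)) ^ 2 -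
        3 * (10 : ℝ) ^ (-b) + ((10 : ℝ) ^ (-b)) ^ 2) := by
    rw [hpb, hpc, hps]; ring
  rw [hBFT]
  have he : (0 : ℝ) < 10 ^ (-b) := by positivity
  have hx : (0 : ℝ) < 10 ^ (-c) := by positivity
  have hy : (0 : ℝ) < 10 ^ (-s) := by positivity
  have hx' : (10 : ℝ) ^ (-c) ≤ 1 / 10 := by
    simpa using ten_zpow_neg_le_div_ten (m := 0) (n := c) (by omega)
  have hy' : (10 : ℝ) ^ (-s) ≤ 1 / 10 := by
    simpa using ten_zpow_neg_le_div_ten (m := 0) (n := s) (by omega)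
  have hex : (10 : ℝ) ^ (-b) ≤ 10 ^ (-c) :=
    zpow_le_zpow_right₀ (by norm_num) (by omega)
  rcases lt_trichotomy c s with h | rfl | h
  · have hB := xpaxos_fault_bounds he hx' hex hy (ten_zpow_neg_le_div_ten h)
    rw [ninesOf_eq_of_mul (m := c) (j := 0) hq (by simpa using hB.1) (by simpa using hB.2),
      if_neg (by omega), min_eq_left h.le]
    ring
  · rcases hbc.lt_or_eq with h | rfl
    · have hez := ten_zpow_neg_le_div_ten h
      rw [ninesOf_eq_of_mul (m := c) (j := 1) hq, if_pos ⟨h, rfl⟩]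
      · ring
      · rw [zpow_one]
        generalize (10 : ℝ) ^ (-b) = e at *
        generalize (10 : ℝ) ^ (-c) = z at *
        have h3 : 0 < z * (17 / 10 - 6 * z - 3 * z * (2 - z) ^ 2) := by
          apply mul_pos hx
          nlinarith [mul_pos hx hx]
        nlinarith
      · rw [zpow_one]
        nlinarith [sq_nonneg ((10 : ℝ) ^ (-c) + 10 ^ (-c) - 10 ^ (-c) * 10 ^ (-c))]
    · rw [ninesOf_eq_of_mul (m := c) (j := 0) hq, if_neg (by omega), min_self]
      · ring
      · rw [zpow_zero]
        generalize (10 : ℝ) ^ (-c) = z at *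
        have h3 : 0 < z * (8 - 5 * z - 3 * z * (2 - z) ^ 2) := by
          apply mul_pos hx
          nlinarith [mul_pos hx hx]
        nlinarith
      · rw [zpow_zero]
        nlinarith [sq_nonneg ((10 : ℝ) ^ (-c) + 10 ^ (-c) - 10 ^ (-c) * 10 ^ (-c))]
  · have hxy := ten_zpow_neg_le_div_ten h
    have hB := xpaxos_fault_bounds he hy' (by linarith) hx hxy
    rw [add_comm ((10 : ℝ) ^ (-c)), mul_comm ((10 : ℝ) ^ (-c))] at hq
    rw [ninesOf_eq_of_mul (m := s) (j := 0) hq (by simpa using hB.1) (by simpa using hB.2),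
      if_neg (by omega), min_eq_right h.le]
    ring
end

section
/- Let a, b be integers with 1 ≤ a < b ≤ 20, and set p_available = 1 − 10^{−a} and p_benign = 1 − 10^{−b}. Then 9of(A_XFT(2)) − 9of(A_CFT(2)) equals 3a − b if b < 3a; equals 1 if 3a ≤ b < 4a; and equals 0 if b ≥ 4a; where A_XFT(2) = Σ_{i=3}^{5} C(5,i) p_available^i (1 − p_available)^{5−i} and A_CFT(2) = Σ_{i=3}^{5} C(5,i) p_available^i (p_benign − p_available)^{5−i}. -/
theorem ninesOf_eq_of_bounds {p : ℝ} {n : ℤ} (hlo : (10 : ℝ) ^ (-(n + 1)) < 1 - p)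
    (hhi : 1 - p ≤ (10 : ℝ) ^ (-n)) : ninesOf p = n := by
  have hpos : 0 < 1 - p := lt_trans (by positivity) hlo
  have hl (m : ℤ) : Real.logb 10 ((10 : ℝ) ^ m) = m := by
    rw [← Real.rpow_intCast, Real.logb_rpow (by norm_num) (by norm_num)]
  have h1 := Real.logb_lt_logb (b := 10) (by norm_num) (by positivity) hlo
  have h2 := Real.logb_le_logb_of_le (b := 10) (by norm_num) hpos hhi
  rw [hl] at h1 h2
  push_cast at h1 h2
  rw [ninesOf, Int.floor_eq_iff]
  constructor <;> linarith

/-- The unavailability of XPaxos on five replicas, each unavailable with probability `q`. -/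
theorem xft_unavail_bounds {q : ℝ} (hq : 0 < q) (hq1 : q ≤ 1 / 10) :
    q ^ 3 < 10 * q ^ 3 - 15 * q ^ 4 + 6 * q ^ 5 ∧
      10 * q ^ 3 - 15 * q ^ 4 + 6 * q ^ 5 ≤ 10 * q ^ 3 := by
  have h3 : 0 < q ^ 3 := by positivity
  constructor <;> nlinarith [mul_pos h3 hq, mul_pos (mul_pos h3 hq) hq]

/-- The unavailability of an asynchronous CFT protocol on five replicas, each unavailable with
probability `q` and non-benign with probability `r`. -/
noncomputable def cftUnavail (q r : ℝ) : ℝ :=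
  (1 - (1 - r) ^ 5) +
    (10 * (1 - q) ^ 2 + 5 * (1 - q) * (q - r) + (q - r) ^ 2) * (q - r) ^ 3

theorem cftUnavail_le {q r : ℝ} (hq1 : q ≤ 1 / 10) (hr : 0 < r) (hrq : r < q) :
    cftUnavail q r ≤ 5 * r + (10 * q ^ 3 - 15 * q ^ 4 + 6 * q ^ 5) := by
  have h1 : 1 - (1 - r) ^ 5 ≤ 5 * r := by
    have := one_add_mul_le_pow (a := -r) (by linarith) 5
    norm_num at this
    linarith
  have hd : 0 ≤ q - r := by linarith
  have hdq : q - r ≤ q := by linarith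
  have hp : 0 ≤ 1 - q := by linarith
  have h2 : (10 * (1 - q) ^ 2 + 5 * (1 - q) * (q - r) + (q - r) ^ 2) * (q - r) ^ 3 ≤
      (10 * (1 - q) ^ 2 + 5 * (1 - q) * q + q ^ 2) * q ^ 3 := by
    gcongr
    nlinarith
  rw [cftUnavail]
  linarith

theorem lt_cftUnavail {q r : ℝ} (hq1 : q ≤ 1 / 10) (hr : 0 < r) (hrq : r < q) :
    r < cftUnavail q r := by
  have hd : 0 < q - r := by linarith
  have hp : 0 < 1 - q := by linarith
  have h2 : 0 < (10 * (1 - q) ^ 2 + 5 * (1 - q) * (q - r) + (q - r) ^ 2) * (q - r) ^ 3 := by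
    positivity
  have h1 : (1 - r) ^ 5 ≤ 1 - r :=
    pow_le_of_le_one (by linarith) (by linarith) (by norm_num)
  rw [cftUnavail]
  linarith

theorem le_cftUnavail {q r : ℝ} (hq1 : q ≤ 1 / 10) (hr : 0 < r) (hrq : r < q) :
    10 * q ^ 3 - 15 * q ^ 4 + r * (5 - 10 * r - 30 * q ^ 2) ≤ cftUnavail q r := by
  have hq : 0 < q := by linarith
  have hd : 0 ≤ q - r := by linarith
  have hp : 0 ≤ 1 - q := by linarith
  have h1 : 5 * r - 10 * r ^ 2 ≤ 1 - (1 - r) ^ 5 := by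
    have : 0 ≤ r ^ 3 * (10 - 5 * r + r ^ 2) :=
      mul_nonneg (by positivity) (by nlinarith)
    linarith
  have h3 : q ^ 3 - 3 * q ^ 2 * r ≤ (q - r) ^ 3 := by
    have : 0 ≤ r ^ 2 * (3 * q - r) := mul_nonneg (by positivity) (by linarith)
    linarith
  have h4 : q ^ 4 - 4 * q ^ 3 * r ≤ (q - r) ^ 4 := by
    have : 0 ≤ r ^ 2 * (6 * q ^ 2 - 4 * q * r + r ^ 2) :=
      mul_nonneg (by positivity) (by nlinarith)
    linarith
  have h5 : 0 ≤ (q - r) ^ 5 := by positivity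
  have h3' := mul_le_mul_of_nonneg_left h3 (by positivity : 0 ≤ 10 * (1 - q) ^ 2)
  have h4' := mul_le_mul_of_nonneg_left h4 (by positivity : 0 ≤ 5 * (1 - q))
  have h6 : 0 ≤ r * q ^ 3 * (40 - 10 * q) := mul_nonneg (by positivity) (by linarith)
  have h7 : 0 ≤ q ^ 5 := by positivity
  rw [cftUnavail]
  linarith

open Finset in
/-- For `t = 2`, the number of nines of availability that XPaxos adds over asynchronous
CFT: `9of(A_XFT(2)) − 9of(A_CFT(2))` equals `3a − b` if `b < 3a`; `1` if
`3a ≤ b < 4a`; and `0` if `b ≥ 4a`. -/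
theorem nines_avail_xpaxos_minus_cft_t2 (a b : ℤ)
    (ha1 : 1 ≤ a) (hab : a < b) (hb20 : b ≤ 20)
    (p_available p_benign : ℝ)
    (hpa : p_available = 1 - (10 : ℝ) ^ (-a))
    (hpb : p_benign = 1 - (10 : ℝ) ^ (-b)) :
    ninesOf (∑ i ∈ Icc 3 5, ((5).choose i : ℝ) *
          p_available ^ i * (1 - p_available) ^ (5 - i)) -
        ninesOf (∑ i ∈ Icc 3 5, ((5).choose i : ℝ) *
          p_available ^ i * (p_benign - p_available) ^ (5 - i)) =
      if b < 3 * a then 3 * a - b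
      else if b < 4 * a then 1
      else 0 := by
  set q : ℝ := (10 : ℝ) ^ (-a) with hq_def
  set r : ℝ := (10 : ℝ) ^ (-b) with hr_def
  have mono {m n : ℤ} (h : m ≤ n) : (10 : ℝ) ^ m ≤ (10 : ℝ) ^ n :=
    zpow_le_zpow_right₀ (by norm_num) h
  have hq : 0 < q := by positivity
  have hr : 0 < r := by positivity
  have hq1 : q ≤ 1 / 10 := by
    have := mono (show -a ≤ -1 by lia)
    norm_num at this ⊢
    simpa [hq_def] using this
  have hrq : r < q := zpow_lt_zpow_right₀ (by norm_num) (by lia)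
  have ten_ne : (10 : ℝ) ≠ 0 := by norm_num
  have q_pow (k : ℕ) : q ^ k = (10 : ℝ) ^ (-(k * a)) := by
    rw [hq_def, ← zpow_natCast, ← zpow_mul]
    congr 1
    ring
  have ten_mul (m : ℤ) : 10 * (10 : ℝ) ^ m = (10 : ℝ) ^ (m + 1) := by
    rw [zpow_add_one₀ ten_ne, mul_comm]
  have q3 : q ^ 3 = (10 : ℝ) ^ (-(3 * a)) := by simpa using q_pow 3
  have q4 : q ^ 4 = (10 : ℝ) ^ (-(4 * a)) := by simpa using q_pow 4
  have q3_ten : 10 * q ^ 3 = (10 : ℝ) ^ (-(3 * a - 1)) := by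
    rw [q3, ten_mul]
    congr 1
    ring
  have q3_hundred : 100 * q ^ 3 = (10 : ℝ) ^ (-(3 * a - 2)) := by
    rw [show 100 * q ^ 3 = 10 * (10 * q ^ 3) by ring, q3_ten, ten_mul]
    congr 1
    ring
  have hIcc : Icc 3 5 = ({3, 4, 5} : Finset ℕ) := by decide
  have c3 : Nat.choose 5 3 = 10 := by decide
  have hX : ninesOf (∑ i ∈ Icc 3 5, ((5).choose i : ℝ) *
      p_available ^ i * (1 - p_available) ^ (5 - i)) = 3 * a - 1 := by
    have e : 1 - ∑ i ∈ Icc 3 5, ((5).choose i : ℝ) *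
        p_available ^ i * (1 - p_available) ^ (5 - i) =
        10 * q ^ 3 - 15 * q ^ 4 + 6 * q ^ 5 := by
      rw [hIcc, hpa]
      simp [c3]
      ring
    obtain ⟨h1, h2⟩ := xft_unavail_bounds hq hq1
    apply ninesOf_eq_of_bounds
    · rwa [e, sub_add_cancel, ← q3]
    · rwa [e, ← q3_ten]
  have e : 1 - ∑ i ∈ Icc 3 5, ((5).choose i : ℝ) *
      p_available ^ i * (p_benign - p_available) ^ (5 - i) = cftUnavail q r := by
    rw [hIcc, hpa, hpb, cftUnavail]
    simp [c3]
    ring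
  have hU := cftUnavail_le hq1 hr hrq
  have hL := le_cftUnavail hq1 hr hrq
  have hf := (xft_unavail_bounds hq hq1).2
  have q3_pos : 0 < q ^ 3 := by positivity
  have q4_pos : 0 < q ^ 4 := by positivity
  have q5_le : q ^ 5 ≤ q ^ 4 / 10 := by nlinarith
  have q4_le : q ^ 4 ≤ q ^ 3 / 10 := by nlinarith
  have q3_le : q ^ 3 ≤ 1 / 1000 := by
    have := pow_le_pow_left₀ hq.le hq1 3
    norm_num at this ⊢
    exact this
  have q2_le : q ^ 2 ≤ 1 / 100 := by
    have := pow_le_pow_left₀ hq.le hq1 2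
    norm_num at this ⊢
    exact this
  rw [hX]
  split_ifs with h3 h4
  · have hr3 : 10 * q ^ 3 ≤ r := by
      rw [q3_ten]
      exact mono (by lia)
    rw [ninesOf_eq_of_bounds (n := b - 1)]
    · ring
    · rw [e, sub_add_cancel]
      exact lt_cftUnavail hq1 hr hrq
    · rw [e, show -(b - 1) = -b + 1 by ring, ← ten_mul, ← hr_def]
      linarith
  · have hr3 : r ≤ q ^ 3 := by
      rw [q3]
      exact mono (by lia)
    have hr4 : 10 * q ^ 4 ≤ r := by
      rw [q4, ten_mul]
      exact mono (by lia)
    rw [ninesOf_eq_of_bounds (n := 3 * a - 2)]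
    · ring
    · rw [e, show 3 * a - 2 + 1 = 3 * a - 1 by ring, ← q3_ten]
      nlinarith
    · rw [e, ← q3_hundred]
      linarith
  · have hr4 : r ≤ q ^ 4 := by
      rw [q4]
      exact mono (by lia)
    rw [ninesOf_eq_of_bounds (n := 3 * a - 1)]
    · ring
    · rw [e, sub_add_cancel, ← q3]
      nlinarith
    · rw [e, ← q3_ten]
      linarith
end

section
/- Let a be an integer with 1 ≤ a ≤ 20 and set p_available = 1 − 10^{−a}. Then 9of(A_XFT(2)) = 9of(A_BFT(2)) + 1 = 3a − 1, where A_XFT(2) = Σ_{i=3}^{5} C(5,i) p_available^i (1 − p_available)^{5−i} and A_BFT(2) = Σ_{i=5}^{7} C(7,i) p_available^i (1 − p_available)^{7−i}. That is, for t = 2, XPaxos achieves exactly one more nine of availability than asynchronous BFT. -/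
theorem ninesOf_eq_of_mem {p : ℝ} {n : ℤ} (hlt : (10 : ℝ) ^ (-(n + 1)) < 1 - p)
    (hle : 1 - p ≤ (10 : ℝ) ^ (-n)) : ninesOf p = n := by
  have hpos : 0 < 1 - p := lt_trans (by positivity) hlt
  have h₁ := Real.logb_lt_logb (b := 10) (by norm_num) (by positivity) hlt
  have h₂ := Real.logb_le_logb_of_le (b := 10) (by norm_num) hpos hle
  rw [← Real.rpow_intCast, Real.logb_rpow (by norm_num) (by norm_num)] at h₁ h₂
  push_cast at h₁ h₂
  rw [ninesOf, Int.floor_eq_iff]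
  constructor <;> linarith

theorem one_sub_avail_xpaxos (p : ℝ) :
    1 - ∑ i ∈ Finset.Icc 3 5, ((5).choose i : ℝ) * p ^ i * (1 - p) ^ (5 - i) =
      (1 - p) ^ 3 * (10 - 15 * (1 - p) + 6 * (1 - p) ^ 2) := by
  norm_num [Finset.sum_Icc_succ_top, Nat.choose]
  ring

theorem one_sub_avail_bft (p : ℝ) :
    1 - ∑ i ∈ Finset.Icc 5 7, ((7).choose i : ℝ) * p ^ i * (1 - p) ^ (7 - i) =
      (1 - p) ^ 3 * (35 - 105 * (1 - p) + 126 * (1 - p) ^ 2 - 70 * (1 - p) ^ 3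
        + 15 * (1 - p) ^ 4) := by
  norm_num [Finset.sum_Icc_succ_top, Nat.choose]
  ring

theorem ten_zpow_neg_three_mul_sub (a k : ℤ) :
    (10 : ℝ) ^ (-(3 * a - k)) = ((10 : ℝ) ^ (-a)) ^ 3 * 10 ^ k := by
  rw [← zpow_natCast, ← zpow_mul, ← zpow_add₀ (by norm_num)]
  congr 1
  push_cast
  ring

open Finset in
/-- For `t = 2`, XPaxos achieves exactly one more nine of availability than asynchronous
BFT: `9of(A_XFT(2)) = 9of(A_BFT(2)) + 1 = 3a − 1`. -/
theorem nines_avail_xpaxos_eq_bft_succ_t2 (a : ℤ) (ha1 : 1 ≤ a) (ha20 : a ≤ 20)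
    (p_available : ℝ) (hpa : p_available = 1 - (10 : ℝ) ^ (-a)) :
    ninesOf (∑ i ∈ Icc 3 5, ((5).choose i : ℝ) *
        p_available ^ i * (1 - p_available) ^ (5 - i)) =
      ninesOf (∑ i ∈ Icc 5 7, ((7).choose i : ℝ) *
        p_available ^ i * (1 - p_available) ^ (7 - i)) + 1 ∧
    ninesOf (∑ i ∈ Icc 3 5, ((5).choose i : ℝ) *
        p_available ^ i * (1 - p_available) ^ (5 - i)) = 3 * a - 1 := by
  obtain ⟨q, hq⟩ : ∃ q : ℝ, q = (10 : ℝ) ^ (-a) := ⟨_, rfl⟩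
  have hq0 : 0 < q := hq ▸ by positivity
  have hq1 : q ≤ 1 / 10 := by
    have h : (10 : ℝ) ^ (-a) ≤ 10 ^ (-1 : ℤ) :=
      zpow_le_zpow_right₀ (by norm_num) (by linarith)
    rw [hq]
    norm_num at h ⊢
    exact h
  have hp : 1 - p_available = q := by rw [hpa, hq]; ring
  have hq3 : 0 < q ^ 3 := by positivity
  have hxft : ninesOf (∑ i ∈ Icc 3 5, ((5).choose i : ℝ) *
      p_available ^ i * (1 - p_available) ^ (5 - i)) = 3 * a - 1 := by
    apply ninesOf_eq_of_mem
    · rw [one_sub_avail_xpaxos, hp, show 3 * a - 1 + 1 = 3 * a - 0 by ring,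
        ten_zpow_neg_three_mul_sub, ← hq]
      refine mul_lt_mul_of_pos_left ?_ hq3
      norm_num
      nlinarith
    · rw [one_sub_avail_xpaxos, hp, ten_zpow_neg_three_mul_sub, ← hq]
      refine mul_le_mul_of_nonneg_left ?_ hq3.le
      norm_num
      nlinarith
  have hbft : ninesOf (∑ i ∈ Icc 5 7, ((7).choose i : ℝ) *
      p_available ^ i * (1 - p_available) ^ (7 - i)) = 3 * a - 2 := by
    have hq2 : q ^ 2 ≤ 1 / 100 := by nlinarith
    have hq3' : q ^ 3 ≤ 1 / 1000 := by nlinarith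
    have hq4 : q ^ 4 ≤ 1 / 10000 := by nlinarith
    apply ninesOf_eq_of_mem
    · rw [one_sub_avail_bft, hp, show 3 * a - 2 + 1 = 3 * a - 1 by ring,
        ten_zpow_neg_three_mul_sub, ← hq]
      refine mul_lt_mul_of_pos_left ?_ hq3
      norm_num
      linarith [sq_nonneg q, pow_nonneg hq0.le 4]
    · rw [one_sub_avail_bft, hp, ten_zpow_neg_three_mul_sub, ← hq]
      refine mul_le_mul_of_nonneg_left ?_ hq3.le
      norm_num
      linarith
  exact ⟨by rw [hxft, hbft]; ring, hxft⟩
end
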